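/- For every a ∈ ℕ₀, every integer N ≥ 2 and every integer k ≥ 0, setting λ_N := 1/(N−1), one has | √(max((N−k)(N−k−1), 0))/(N−1) − Σ_{ℓ=0}^{a} λ_N^{ℓ} Σ_{j=0}^{ℓ} d_{ℓ,j} · (k−1)^j | ≤ λ_N^{a+1} · (a+1)² · 4^{a+1} · (k+1)^{a+1}. -/

import Mathlib

/-- The Taylor coefficients `c_j^{(ℓ)} = (ℓ−1/2)(ℓ+1/2)⋯(ℓ+j−3/2)/j!` (with `c_0^{(ℓ)} = 1`). -/
noncomputable def taylorCoeffC (ℓ j : ℕ) : ℝ :=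
  (∏ i ∈ Finset.range j, ((ℓ : ℝ) - 1 / 2 + i)) / (Nat.factorial j)

/-- The coefficients `d_{ℓ,j} = Σ_{i=0}^j c_i^{(0)} c_{j−i}^{(0)} c_{ℓ−j}^{(i)}`. -/
noncomputable def taylorCoeffD (ℓ j : ℕ) : ℝ :=
  ∑ i ∈ Finset.range (j + 1), taylorCoeffC 0 i * taylorCoeffC 0 (j - i) * taylorCoeffC i (ℓ - j)

open Finset in
theorem taylorCoeffC_zero_mul_choose (n j : ℕ) (h : j ≤ n) :
    taylorCoeffC 0 n * n.choose j = taylorCoeffC 0 j * taylorCoeffC j (n - j) := by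
  obtain ⟨m, rfl⟩ := Nat.exists_eq_add_of_le h
  have h₁ : ((j + m).choose j : ℝ) * (j.factorial * m.factorial) = (j + m).factorial := by
    have := Nat.choose_mul_factorial_mul_factorial (Nat.le_add_right j m)
    rw [← this, Nat.add_sub_cancel_left]
    push_cast
    ring
  have h₂ : ∀ i : ℕ, ((0 : ℕ) : ℝ) - 1 / 2 + ((j + i : ℕ) : ℝ) = (j : ℝ) - 1 / 2 + i := by
    intro i
    push_cast
    ring
  simp only [taylorCoeffC, prod_range_add, Nat.add_sub_cancel_left, h₂]
  have h₃ : (j.factorial : ℝ) ≠ 0 := by positivity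
  have h₄ : (m.factorial : ℝ) ≠ 0 := by positivity
  have h₅ : ((j + m).factorial : ℝ) ≠ 0 := by positivity
  rw [div_mul_eq_mul_div, div_mul_div_comm, div_eq_div_iff h₅ (mul_ne_zero h₃ h₄), ← h₁]
  ring

open Finset in
theorem taylorCoeffC_zero_mul_add_one_pow (n : ℕ) (x : ℝ) :
    taylorCoeffC 0 n * (x + 1) ^ n =
      ∑ i ∈ range (n + 1), taylorCoeffC 0 i * taylorCoeffC i (n - i) * x ^ i := by
  rw [add_pow, mul_sum]
  refine sum_congr rfl fun i hi => ?_
  rw [← taylorCoeffC_zero_mul_choose n i (by simpa [Nat.lt_succ_iff] using hi)]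
  ring

open Finset in
theorem sum_taylorCoeffD_mul_pow (n : ℕ) (x : ℝ) :
    ∑ j ∈ range (n + 1), taylorCoeffD n j * x ^ j =
      ∑ q ∈ range (n + 1), taylorCoeffC 0 q * x ^ q *
        (taylorCoeffC 0 (n - q) * (x + 1) ^ (n - q)) := by
  have h := sum_range_diag_flip (n + 1) fun q i =>
    taylorCoeffC 0 q * x ^ q * (taylorCoeffC 0 i * taylorCoeffC i (n - q - i) * x ^ i)
  trans ∑ j ∈ range (n + 1), ∑ q ∈ range (j + 1), taylorCoeffC 0 q * x ^ q *
      (taylorCoeffC 0 (j - q) * taylorCoeffC (j - q) (n - q - (j - q)) * x ^ (j - q))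
  · refine sum_congr rfl fun j _ => ?_
    rw [taylorCoeffD, sum_mul, ← sum_flip]
    refine sum_congr rfl fun q hq => ?_
    have hq : q ≤ j := by simpa [Nat.lt_succ_iff] using hq
    rw [Nat.sub_sub_self hq, show n - q - (j - q) = n - j by omega,
      show x ^ j = x ^ q * x ^ (j - q) by rw [← pow_add, Nat.add_sub_cancel' hq]]
    ring
  · rw [h]
    refine sum_congr rfl fun q hq => ?_
    have hq : q ≤ n := by simpa [Nat.lt_succ_iff] using hq
    rw [taylorCoeffC_zero_mul_add_one_pow, mul_sum, Nat.sub_add_comm hq]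

theorem taylorCoeffC_zero_right (l : ℕ) : taylorCoeffC l 0 = 1 := by
  simp [taylorCoeffC]

theorem taylorCoeffC_succ (l n : ℕ) :
    taylorCoeffC l (n + 1) = taylorCoeffC l n * ((l - 1 / 2 + n) / (n + 1)) := by
  rw [taylorCoeffC, taylorCoeffC, Finset.prod_range_succ, Nat.factorial_succ]
  push_cast
  field_simp

theorem abs_taylorCoeffC_zero_succ_le (n : ℕ) : |taylorCoeffC 0 (n + 1)| ≤ 1 / 2 := by
  induction n with
  | zero => norm_num [taylorCoeffC_succ, taylorCoeffC_zero_right]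
  | succ n ih =>
    rw [taylorCoeffC_succ, abs_mul]
    refine (mul_le_of_le_one_right (abs_nonneg _) ?_).trans ih
    push_cast
    rw [abs_div, abs_of_pos (by positivity : (0 : ℝ) < n + 1 + 1), div_le_one (by positivity),
      abs_le]
    constructor <;> linarith [(n.cast_nonneg : (0 : ℝ) ≤ n)]

theorem abs_taylorCoeffC_zero_le_one (n : ℕ) : |taylorCoeffC 0 n| ≤ 1 := by
  cases n with
  | zero => simp [taylorCoeffC_zero_right]
  | succ n => linarith [abs_taylorCoeffC_zero_succ_le n]

theorem choose_half_eq_taylorCoeffC (n : ℕ) :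
    Ring.choose (1 / 2 : ℝ) n = (-1) ^ n * taylorCoeffC 0 n := by
  induction n with
  | zero => simp [taylorCoeffC_zero_right]
  | succ n ih =>
    have h : Ring.choose (1 / 2 : ℝ) (n + 1) =
        Ring.choose (1 / 2 : ℝ) n * ((1 / 2 - n) / (n + 1)) := by
      simp only [Ring.choose_eq_smul, descPochhammer_succ_right, Polynomial.smeval_mul,
        Polynomial.smeval_sub, Polynomial.smeval_X, Polynomial.smeval_natCast, Nat.factorial_succ,
        smul_eq_mul, pow_one, pow_zero, nsmul_eq_mul, mul_one]
      push_cast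
      field_simp
    rw [h, ih, taylorCoeffC_succ]
    push_cast
    ring

theorem hasSum_taylorCoeffC_sqrt_one_sub {x : ℝ} (hx : |x| < 1) :
    HasSum (fun n => taylorCoeffC 0 n * x ^ n) √(1 - x) := by
  have hx' : -x ∈ Metric.eball (0 : ℝ) 1 := by
    rw [← ENNReal.ofReal_one, Metric.eball_ofReal]
    simpa using hx
  have h := (Real.one_add_rpow_hasFPowerSeriesOnBall_zero (a := 1 / 2)).hasSum hx'
  simp only [binomialSeries_apply, List.ofFn_const, List.prod_replicate, smul_eq_mul,
    choose_half_eq_taylorCoeffC, ← Real.sqrt_eq_rpow] at h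
  rw [zero_add, ← sub_eq_add_neg] at h
  refine h.congr_fun fun n => ?_
  rw [neg_pow x, mul_mul_mul_comm, ← mul_pow]
  simp

theorem abs_sqrt_one_sub_sub_sum_le {x z : ℝ} (hx : |x| ≤ z) (hz : z ≤ 1 / 2) (n : ℕ) :
    |√(1 - x) - ∑ j ∈ Finset.range (n + 1), taylorCoeffC 0 j * x ^ j| ≤ z ^ (n + 1) := by
  have hz₀ : 0 ≤ z := (abs_nonneg x).trans hx
  have h := (hasSum_nat_add_iff' (n + 1)).2
    (hasSum_taylorCoeffC_sqrt_one_sub (x := x) (by linarith))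
  have hg : HasSum (fun i : ℕ => 1 / 2 * z ^ (n + 1) * (1 / 2) ^ i) (1 / 2 * z ^ (n + 1) * 2) :=
    hasSum_geometric_two.mul_left _
  refine (h.norm_le_of_bounded hg fun i => ?_).trans_eq (by ring)
  rw [Real.norm_eq_abs, abs_mul, abs_pow, add_comm i, pow_add, mul_assoc,
    show n + 1 + i = n + i + 1 by ring]
  have := abs_taylorCoeffC_zero_succ_le (n + i)
  have : |x| ≤ 1 / 2 := hx.trans hz
  gcongr

open Finset in
theorem abs_sqrt_mul_sqrt_sub_sum_le {x y z : ℝ} (hx : |x| ≤ z) (hy : |y| ≤ z)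
    (hz : z ≤ 1 / 2) (a : ℕ) :
    |√(1 - x) * √(1 - y) - ∑ n ∈ range (a + 1), ∑ q ∈ range (n + 1),
      taylorCoeffC 0 q * x ^ q * (taylorCoeffC 0 (n - q) * y ^ (n - q))| ≤
        (a + 3) * z ^ (a + 1) := by
  have hz₀ : 0 ≤ z := (abs_nonneg x).trans hx
  have hsplit : √(1 - x) * √(1 - y) - ∑ q ∈ range (a + 1), ∑ i ∈ range (a + 1 - q),
      taylorCoeffC 0 q * x ^ q * (taylorCoeffC 0 i * y ^ i) =
      (√(1 - x) - ∑ q ∈ range (a + 1), taylorCoeffC 0 q * x ^ q) * √(1 - y) +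
      ∑ q ∈ range (a + 1), taylorCoeffC 0 q * x ^ q *
        (√(1 - y) - ∑ i ∈ range (a + 1 - q), taylorCoeffC 0 i * y ^ i) := by
    simp only [← mul_sum, mul_sub, sum_sub_distrib, ← sum_mul]
    ring
  rw [sum_range_diag_flip (a + 1) fun q i =>
    taylorCoeffC 0 q * x ^ q * (taylorCoeffC 0 i * y ^ i), hsplit]
  have hy₂ : √(1 - y) ≤ 2 := Real.sqrt_le_iff.2 ⟨by norm_num, by linarith [neg_abs_le y]⟩
  have h₁ : |(√(1 - x) - ∑ q ∈ range (a + 1), taylorCoeffC 0 q * x ^ q) * √(1 - y)| ≤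
      z ^ (a + 1) * 2 := by
    rw [abs_mul, abs_of_nonneg (Real.sqrt_nonneg (1 - y))]
    exact mul_le_mul (abs_sqrt_one_sub_sub_sum_le hx hz a) hy₂ (Real.sqrt_nonneg _) (by positivity)
  have h₂ : |∑ q ∈ range (a + 1), taylorCoeffC 0 q * x ^ q *
      (√(1 - y) - ∑ i ∈ range (a + 1 - q), taylorCoeffC 0 i * y ^ i)| ≤
      ∑ _q ∈ range (a + 1), z ^ (a + 1) := by
    refine (abs_sum_le_sum_abs _ _).trans (sum_le_sum fun q hq => ?_)
    obtain ⟨b, rfl⟩ := Nat.exists_eq_add_of_le (Nat.lt_succ_iff.1 (mem_range.1 hq))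
    rw [show q + b + 1 - q = b + 1 by omega, add_assoc, pow_add, abs_mul, abs_mul, abs_pow]
    have h₃ : |taylorCoeffC 0 q| * |x| ^ q ≤ z ^ q :=
      (mul_le_of_le_one_left (by positivity) (abs_taylorCoeffC_zero_le_one q)).trans
        (pow_le_pow_left₀ (abs_nonneg x) hx q)
    exact mul_le_mul h₃ (abs_sqrt_one_sub_sub_sum_le hy hz b) (abs_nonneg _) (by positivity)
  refine (abs_add_le _ _).trans ((add_le_add h₁ h₂).trans_eq ?_)
  simp only [sum_const, card_range, nsmul_eq_mul]
  push_cast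
  ring

open Finset in
theorem abs_sqrt_max_mul_sub_sum_le {x y z : ℝ} (hx : |x| ≤ z) (hy : |y| ≤ z)
    (hz : 1 / 2 ≤ z) (a : ℕ) :
    |√(max ((1 - x) * (1 - y)) 0) - ∑ n ∈ range (a + 1), ∑ q ∈ range (n + 1),
      taylorCoeffC 0 q * x ^ q * (taylorCoeffC 0 (n - q) * y ^ (n - q))| ≤
        (a + 1) * (2 * z) ^ (a + 1) := by
  have hz₁ : 1 ≤ 2 * z := by linarith
  have hterm : ∀ n, |∑ q ∈ range (n + 1),
      taylorCoeffC 0 q * x ^ q * (taylorCoeffC 0 (n - q) * y ^ (n - q))| ≤ (2 * z) ^ n := by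
    intro n
    have h : ∀ q ∈ range (n + 1),
        |taylorCoeffC 0 q * x ^ q * (taylorCoeffC 0 (n - q) * y ^ (n - q))| ≤ z ^ n := by
      intro q hq
      rw [← Nat.add_sub_cancel' (Nat.lt_succ_iff.1 (mem_range.1 hq)), pow_add,
        Nat.add_sub_cancel_left, abs_mul, abs_mul, abs_mul, abs_pow, abs_pow]
      have h₁ := abs_taylorCoeffC_zero_le_one q
      have h₂ := abs_taylorCoeffC_zero_le_one (n - q)
      calc _ ≤ 1 * z ^ q * (1 * z ^ (n - q)) := by gcongr
        _ = _ := by ring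
    calc _ ≤ ∑ _q ∈ range (n + 1), z ^ n := (abs_sum_le_sum_abs _ _).trans (sum_le_sum h)
      _ = (n + 1 : ℕ) * z ^ n := by simp
      _ ≤ 2 ^ n * z ^ n := by
        gcongr
        exact_mod_cast Nat.lt_two_pow_self
      _ = _ := (mul_pow _ _ _).symm
  have hf : |√(max ((1 - x) * (1 - y)) 0) - 1| ≤ (2 * z) ^ (a + 1) := by
    have h₁ : √(max ((1 - x) * (1 - y)) 0) ≤ 1 + z := by
      refine Real.sqrt_le_iff.2 ⟨by linarith, max_le ?_ (by positivity)⟩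
      have := abs_le.1 hx
      have := abs_le.1 hy
      calc (1 - x) * (1 - y) ≤ |1 - x| * |1 - y| := (le_abs_self _).trans_eq (abs_mul _ _)
        _ ≤ (1 + z) * (1 + z) := by
          gcongr <;> rw [abs_le] <;> constructor <;> linarith
        _ = _ := (sq _).symm
    have h₂ := Real.sqrt_nonneg (max ((1 - x) * (1 - y)) 0)
    refine le_trans ?_ (le_self_pow₀ hz₁ (Nat.succ_ne_zero a))
    rw [abs_le]
    constructor <;> linarith
  rw [sum_range_succ']
  have hsum : |∑ n ∈ range a, ∑ q ∈ range (n + 1 + 1), taylorCoeffC 0 q * x ^ q *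
      (taylorCoeffC 0 (n + 1 - q) * y ^ (n + 1 - q))| ≤ ∑ _n ∈ range a, (2 * z) ^ (a + 1) := by
    refine (abs_sum_le_sum_abs _ _).trans (sum_le_sum fun n hn => (hterm (n + 1)).trans ?_)
    have := mem_range.1 hn
    exact pow_le_pow_right₀ hz₁ (by omega)
  simp only [zero_add, sum_range_one, taylorCoeffC_zero_right, pow_zero, mul_one, Nat.sub_zero]
  rw [sum_const, card_range, nsmul_eq_mul] at hsum
  rw [sub_add_eq_sub_sub_swap]
  refine (abs_sub _ _).trans ((add_le_add hf hsum).trans_eq ?_)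
  ring

/-- Scalar form of the Taylor expansion of `√([(N−𝒩)(N−𝒩−1)]₊)/(N−1)` on the `k`-particle
sector: `|√(max((N−k)(N−k−1),0))/(N−1) − Σ_{ℓ=0}^a λ_N^ℓ Σ_{j=0}^ℓ d_{ℓ,j} (k−1)^j|
≤ λ_N^{a+1} (a+1)² 4^{a+1} (k+1)^{a+1}` with `λ_N = 1/(N−1)`. -/
theorem sqrt_N_minus_k_squared_taylor_remainder (a N k : ℕ) (hN : 2 ≤ N) :
    |Real.sqrt (max (((N : ℝ) - k) * ((N : ℝ) - k - 1)) 0) / ((N : ℝ) - 1) -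
        ∑ ℓ ∈ Finset.range (a + 1),
          (1 / ((N : ℝ) - 1)) ^ ℓ *
            ∑ j ∈ Finset.range (ℓ + 1), taylorCoeffD ℓ j * ((k : ℝ) - 1) ^ j| ≤
      (1 / ((N : ℝ) - 1)) ^ (a + 1) * ((a : ℝ) + 1) ^ 2 * 4 ^ (a + 1) *
        ((k : ℝ) + 1) ^ (a + 1) := by
  have hN₁ : (0 : ℝ) < N - 1 := by
    have : (2 : ℝ) ≤ N := by exact_mod_cast hN
    linarith
  have hk : (0 : ℝ) ≤ k := k.cast_nonneg
  set l : ℝ := 1 / ((N : ℝ) - 1) with hl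
  have hl₀ : 0 < l := by positivity
  have hlN : l * (N - 1) = 1 := by rw [hl]; field_simp
  have hx : |l * ((k : ℝ) - 1)| ≤ l * (k + 1) := by
    rw [abs_mul, abs_of_pos hl₀]
    gcongr
    rw [abs_le]
    constructor <;> linarith
  have hy : |l * (k : ℝ)| ≤ l * (k + 1) := by
    rw [abs_of_nonneg (by positivity)]
    gcongr
    linarith
  have hf : √(max (((N : ℝ) - k) * ((N : ℝ) - k - 1)) 0) / ((N : ℝ) - 1) =
      √(max ((1 - l * ((k : ℝ) - 1)) * (1 - l * k)) 0) := by
    have h₁ : (1 - l * ((k : ℝ) - 1)) * (1 - l * k) =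
        l ^ 2 * (((N : ℝ) - k) * ((N : ℝ) - k - 1)) := by
      linear_combination (-(1 - l * (k : ℝ)) - l * (N - k)) * hlN
    have h₂ := mul_max_of_nonneg (((N : ℝ) - k) * ((N : ℝ) - k - 1)) 0 (sq_nonneg l)
    rw [mul_zero] at h₂
    rw [h₁, ← h₂, Real.sqrt_mul (sq_nonneg l), Real.sqrt_sq hl₀.le, hl]
    ring
  have hS : ∀ n : ℕ, l ^ n * ∑ j ∈ Finset.range (n + 1), taylorCoeffD n j * ((k : ℝ) - 1) ^ j =
      ∑ q ∈ Finset.range (n + 1), taylorCoeffC 0 q * (l * ((k : ℝ) - 1)) ^ q *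
        (taylorCoeffC 0 (n - q) * (l * k) ^ (n - q)) := by
    intro n
    rw [sum_taylorCoeffD_mul_pow, Finset.mul_sum]
    refine Finset.sum_congr rfl fun q hq => ?_
    rw [← Nat.add_sub_cancel' (Nat.lt_succ_iff.1 (Finset.mem_range.1 hq)), pow_add,
      Nat.add_sub_cancel_left, sub_add_cancel, mul_pow, mul_pow]
    ring
  simp only [hS]
  rw [hf, show l ^ (a + 1) * ((a : ℝ) + 1) ^ 2 * 4 ^ (a + 1) * ((k : ℝ) + 1) ^ (a + 1) =
    (a + 1) ^ 2 * 4 ^ (a + 1) * (l * (k + 1)) ^ (a + 1) by rw [mul_pow]; ring]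
  have ha : (0 : ℝ) ≤ a := a.cast_nonneg
  have ha₁ : (a : ℝ) + 1 ≤ (a + 1) ^ 2 := by nlinarith
  rcases le_total (l * ((k : ℝ) + 1)) (1 / 2) with hz | hz
  · have hx₁ : 0 ≤ 1 - l * ((k : ℝ) - 1) := by linarith [le_abs_self (l * ((k : ℝ) - 1))]
    have hy₁ : 0 ≤ 1 - l * (k : ℝ) := by linarith [le_abs_self (l * (k : ℝ))]
    rw [max_eq_left (mul_nonneg hx₁ hy₁), Real.sqrt_mul hx₁]
    refine (abs_sqrt_mul_sqrt_sub_sum_le hx hy hz a).trans ?_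
    gcongr
    have h₄ : (4 : ℝ) ≤ 4 ^ (a + 1) := le_self_pow₀ (by norm_num) (Nat.succ_ne_zero a)
    nlinarith
  · refine (abs_sqrt_max_mul_sub_sum_le hx hy hz a).trans ?_
    rw [mul_pow, ← mul_assoc]
    gcongr
    norm_num
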